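/- Let A : [0,∞) → ℝ be twice continuously differentiable with A(λ) > 0 for all λ ≥ 0, A(0) = 1, A′(0) = 0, and suppose 2λ(1+λ²)A′(λ)² + (9λ²+4)A(λ)A′(λ) + λ(1+λ²)A(λ)A″(λ) + 4λA(λ)² = 0 for all λ > 0. Then A(λ) = exp(∫₀^λ β(μ) dμ) for all λ ≥ 0. -/

import Mathlib

open Set

/-- The logarithmic derivative `β = A′/A` of the deformed conifold metric
component function, equation (13) of the paper. -/
noncomputable def betaFn (l : ℝ) : ℝ :=
  -(((4 * l ^ 5 + 4 * l ^ 3 + 3 * l) * Real.sqrt (1 + l ^ 2) -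
        (6 * l ^ 2 + 3) * Real.arsinh l) /
    (3 * l * ((2 * l ^ 5 + 3 * l ^ 3 + l) * Real.sqrt (1 + l ^ 2) -
        (1 + l ^ 2) * Real.arsinh l)))

lemma hasDerivAt_sqrt_one_add_sq (l : ℝ) :
    HasDerivAt (fun x : ℝ => √(1 + x ^ 2)) (l / √(1 + l ^ 2)) l := by
  have h : HasDerivAt (fun x : ℝ => 1 + x ^ 2) (2 * l) l := by
    simpa using ((hasDerivAt_id l).pow 2).const_add 1
  convert h.sqrt (by positivity) using 1
  field_simp

/-- Up to the factor `8`, the function `(2l³ + l)√(1 + l²) - arsinh l` is the primitive of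
`l²√(1 + l²)` vanishing at `0`. -/
lemma hasDerivAt_sqrt_sub_arsinh (l : ℝ) :
    HasDerivAt (fun x : ℝ => (2 * x ^ 3 + x) * √(1 + x ^ 2) - Real.arsinh x)
      (8 * l ^ 2 * √(1 + l ^ 2)) l := by
  have hp : HasDerivAt (fun x : ℝ => 2 * x ^ 3 + x) (6 * l ^ 2 + 1) l := by
    refine ((((hasDerivAt_id l).pow 3).const_mul 2).add (hasDerivAt_id l)).congr_deriv ?_
    simp; ring
  have hs : 0 < √(1 + l ^ 2) := by positivity
  have hs2 : √(1 + l ^ 2) ^ 2 = 1 + l ^ 2 := Real.sq_sqrt (by positivity)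
  refine ((hp.mul (hasDerivAt_sqrt_one_add_sq l)).sub (Real.hasDerivAt_arsinh l)).congr_deriv ?_
  field_simp
  rw [hs2]
  ring

lemma eq_of_hasDerivWithinAt_Ici_zero {f f' : ℝ → ℝ} {a : ℝ}
    (hf : ∀ l ∈ Ici a, HasDerivWithinAt f (f' l) (Ici a) l)
    (hf' : ∀ l ∈ Ici a, f' l = 0) {l : ℝ} (hl : a ≤ l) : f l = f a := by
  refine constant_of_has_deriv_right_zero (b := l)
    (fun x hx => ((hf x hx.1).mono Icc_subset_Ici_self).continuousWithinAt)
    (fun x hx => ?_) l ⟨hl, le_rfl⟩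
  rw [← hf' x hx.1]
  exact (hf x hx.1).mono (Ici_subset_Ici.2 hx.1)

section RicciFlat

variable {A A' A'' : ℝ → ℝ}

/-- A first integral of the Ricci-flatness equation, which is linear in `A³`. -/
lemma ricci_flat_first_integral
    (hA : ∀ l ∈ Ici (0 : ℝ), HasDerivWithinAt A (A' l) (Ici 0) l)
    (hA' : ∀ l ∈ Ici (0 : ℝ), HasDerivWithinAt A' (A'' l) (Ici 0) l)
    (hA0 : A 0 = 1) (hA'0 : A' 0 = 0)
    (hODE : ∀ l > (0 : ℝ),
      2 * l * (1 + l ^ 2) * (A' l) ^ 2 + (9 * l ^ 2 + 4) * A l * A' l +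
        l * (1 + l ^ 2) * A l * A'' l + 4 * l * (A l) ^ 2 = 0)
    {l : ℝ} (hl : 0 ≤ l) :
    (1 + 2 * l ^ 2) * A l ^ 3 + l * (1 + l ^ 2) * A l ^ 2 * A' l = 1 := by
  have hODE' : ∀ l ∈ Ici (0 : ℝ),
      A l * (2 * l * (1 + l ^ 2) * (A' l) ^ 2 + (9 * l ^ 2 + 4) * A l * A' l +
        l * (1 + l ^ 2) * A l * A'' l + 4 * l * (A l) ^ 2) = 0 := by
    intro l hl
    rcases (mem_Ici.1 hl).eq_or_lt with rfl | hl
    · simp [hA'0]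
    · rw [hODE l hl, mul_zero]
  have hderiv : ∀ l ∈ Ici (0 : ℝ), HasDerivWithinAt
      (fun x => (1 + 2 * x ^ 2) * A x ^ 3 + x * (1 + x ^ 2) * A x ^ 2 * A' x)
      (A l * (2 * l * (1 + l ^ 2) * (A' l) ^ 2 + (9 * l ^ 2 + 4) * A l * A' l +
        l * (1 + l ^ 2) * A l * A'' l + 4 * l * (A l) ^ 2)) (Ici 0) l := by
    intro l hl
    have hid := hasDerivWithinAt_id l (Ici (0 : ℝ))
    refine (((((hid.pow 2).const_mul 2).const_add 1).mul ((hA l hl).pow 3)).add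
      (((hid.mul ((hid.pow 2).const_add 1)).mul ((hA l hl).pow 2)).mul (hA' l hl))).congr_deriv ?_
    simp; ring
  have := eq_of_hasDerivWithinAt_Ici_zero hderiv hODE' hl
  simpa [hA0] using this

lemma ricci_flat_cube_formula
    (hA : ∀ l ∈ Ici (0 : ℝ), HasDerivWithinAt A (A' l) (Ici 0) l)
    (hK : ∀ l ∈ Ici (0 : ℝ),
      (1 + 2 * l ^ 2) * A l ^ 3 + l * (1 + l ^ 2) * A l ^ 2 * A' l = 1)
    {l : ℝ} (hl : 0 ≤ l) :
    8 * (l * √(1 + l ^ 2) * A l) ^ 3 =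
      3 * ((2 * l ^ 3 + l) * √(1 + l ^ 2) - Real.arsinh l) := by
  have hderiv : ∀ l ∈ Ici (0 : ℝ), HasDerivWithinAt
      (fun x => 8 * (x * √(1 + x ^ 2) * A x) ^ 3 -
        3 * ((2 * x ^ 3 + x) * √(1 + x ^ 2) - Real.arsinh x))
      (24 * l ^ 2 * √(1 + l ^ 2) *
        ((1 + 2 * l ^ 2) * A l ^ 3 + l * (1 + l ^ 2) * A l ^ 2 * A' l - 1)) (Ici 0) l := by
    intro l hl
    have hs : 0 < √(1 + l ^ 2) := by positivity
    have hs2 : √(1 + l ^ 2) ^ 2 = 1 + l ^ 2 := Real.sq_sqrt (by positivity)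
    refine ((((((hasDerivWithinAt_id l (Ici (0 : ℝ))).mul
      (hasDerivAt_sqrt_one_add_sq l).hasDerivWithinAt).mul (hA l hl)).pow 3).const_mul 8).sub
      ((hasDerivAt_sqrt_sub_arsinh l).hasDerivWithinAt.const_mul 3)).congr_deriv ?_
    simp
    field_simp
    ring_nf
    simp only [hs2]
    ring
  have := eq_of_hasDerivWithinAt_Ici_zero hderiv
    (fun x hx => by rw [hK x hx, sub_self, mul_zero]) hl
  simp at this
  linarith

lemma ricci_flat_logDeriv_eq_betaFn
    (hApos : ∀ l ≥ (0 : ℝ), 0 < A l) {l : ℝ} (hl : 0 < l)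
    (hK : (1 + 2 * l ^ 2) * A l ^ 3 + l * (1 + l ^ 2) * A l ^ 2 * A' l = 1)
    (hH : 8 * (l * √(1 + l ^ 2) * A l) ^ 3 =
      3 * ((2 * l ^ 3 + l) * √(1 + l ^ 2) - Real.arsinh l)) :
    A' l / A l = betaFn l := by
  have hAl := hApos l hl.le
  have hs : 0 < √(1 + l ^ 2) := by positivity
  have hs2 : √(1 + l ^ 2) ^ 2 = 1 + l ^ 2 := Real.sq_sqrt (by positivity)
  have harsinh : Real.arsinh l = (2 * l ^ 3 + l) * √(1 + l ^ 2) -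
      8 / 3 * (l ^ 3 * (1 + l ^ 2) * √(1 + l ^ 2) * A l ^ 3) := by
    rw [mul_pow, mul_pow, pow_succ √(1 + l ^ 2) 2, hs2] at hH
    linarith
  have hA' : A' l = (1 - (1 + 2 * l ^ 2) * A l ^ 3) / (l * (1 + l ^ 2) * A l ^ 2) := by
    rw [eq_div_iff (by positivity)]
    linarith
  have hnum : (4 * l ^ 5 + 4 * l ^ 3 + 3 * l) * √(1 + l ^ 2) - (6 * l ^ 2 + 3) * Real.arsinh l =
      8 * l ^ 3 * (1 + l ^ 2) * √(1 + l ^ 2) * ((1 + 2 * l ^ 2) * A l ^ 3 - 1) := by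
    rw [harsinh]; ring
  have hden : (2 * l ^ 5 + 3 * l ^ 3 + l) * √(1 + l ^ 2) - (1 + l ^ 2) * Real.arsinh l =
      8 / 3 * (l ^ 3 * (1 + l ^ 2) ^ 2 * √(1 + l ^ 2) * A l ^ 3) := by
    rw [harsinh]; ring
  rw [betaFn, hnum, hden, hA']
  field_simp
  ring

end RicciFlat

/-- Uniqueness of the deformed conifold metric: any `C²` function `A > 0` on
`[0,∞)` with `A(0) = 1`, `A′(0) = 0` satisfying the Ricci-flatness ODE
`2λ(1+λ²)(A′)² + (9λ²+4)AA′ + λ(1+λ²)AA″ + 4λA² = 0` on `(0,∞)` equals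
`exp(∫₀^λ β)`. -/
theorem ricci_flat_unique_regular_solution (A A' A'' : ℝ → ℝ)
    (hA : ∀ l ∈ Set.Ici (0 : ℝ), HasDerivWithinAt A (A' l) (Set.Ici 0) l)
    (hA' : ∀ l ∈ Set.Ici (0 : ℝ), HasDerivWithinAt A' (A'' l) (Set.Ici 0) l)
    (hA''cont : ContinuousOn A'' (Set.Ici 0))
    (hApos : ∀ l ≥ (0 : ℝ), 0 < A l)
    (hA0 : A 0 = 1) (hA'0 : A' 0 = 0)
    (hODE : ∀ l > (0 : ℝ),
      2 * l * (1 + l ^ 2) * (A' l) ^ 2 + (9 * l ^ 2 + 4) * A l * A' l +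
        l * (1 + l ^ 2) * A l * A'' l + 4 * l * (A l) ^ 2 = 0) :
    ∀ l ≥ (0 : ℝ), A l = Real.exp (∫ m in (0 : ℝ)..l, betaFn m) := by
  have hK := fun l (hl : l ∈ Ici (0 : ℝ)) =>
    ricci_flat_first_integral hA hA' hA0 hA'0 hODE (mem_Ici.1 hl)
  have hbeta : ∀ l ∈ Ici (0 : ℝ), A' l / A l = betaFn l := by
    intro l hl
    rcases (mem_Ici.1 hl).eq_or_lt with rfl | hpos
    · simp [hA'0, betaFn]
    · exact ricci_flat_logDeriv_eq_betaFn hApos hpos (hK l hl)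
        (ricci_flat_cube_formula hA hK hpos.le)
  have hAcont : ContinuousOn A (Ici 0) := fun x hx => (hA x hx).continuousWithinAt
  have hA'cont : ContinuousOn A' (Ici 0) := fun x hx => (hA' x hx).continuousWithinAt
  have hbetacont : ContinuousOn betaFn (Ici 0) :=
    (hA'cont.div hAcont fun x hx => (hApos x hx).ne').congr fun x hx => (hbeta x hx).symm
  intro l hl
  have hint : ∫ m in (0 : ℝ)..l, betaFn m = Real.log (A l) - Real.log (A 0) := by
    refine intervalIntegral.integral_eq_sub_of_hasDerivAt_of_le hl
      ((hAcont.mono Icc_subset_Ici_self).log fun x hx => (hApos x hx.1).ne')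
      (fun x hx => ?_)
      ((hbetacont.mono Icc_subset_Ici_self).intervalIntegrable_of_Icc hl)
    rw [← hbeta x hx.1.le]
    exact ((hA x hx.1.le).hasDerivAt (Ici_mem_nhds hx.1)).log (hApos x hx.1.le).ne'
  rw [hint, hA0, Real.log_one, sub_zero, Real.exp_log (hApos l hl)]
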